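/- For a G-coalgebra C̲, the following conditions are equivalent: (1) C̲ is cocleft, i.e. there exist k-linear maps u_α ∈ C_α* and v_α ∈ C_{α⁻¹}* (α ∈ G) such that u_α(c_{(1,α)}) v_α(c_{(2,α⁻¹)}) = v_α(c_{(1,α⁻¹)}) u_α(c_{(2,α)}) = ε(c) for all c ∈ C_e; (2) C̲ is isomorphic as a G-coalgebra to a crossed coproduct C ⋊_f k⟨G⟩ for some k-coalgebra C with weak G-action λ and factor set f; (3) C̲ is isomorphic to a crossed coproduct C ⋊_f k⟨G⟩ with f normalized (f_{α,e} = f_{e,α} = ε_C for all α); (4) C̲ is a strong G-coalgebra and every C_α is isomorphic to C_e as a left C_e-comodule. -/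

import Mathlib

open TensorProduct

universe u

/-- A `G`-group coalgebra over `k`: a family of `k`-vector spaces `C α` with
comultiplications `Δ_{α,β} : C (α*β) → C α ⊗ C β` and a counit `ε : C 1 → k`.
The comultiplication takes an explicit proof `γ = α * β` to avoid dependent casts. -/
structure GCoalgebra (k : Type u) [Field k] (G : Type u) [Group G] where
  C : G → Type u
  [acg : ∀ α, AddCommGroup (C α)]
  [mod : ∀ α, Module k (C α)]
  Δ : ∀ ⦃γ⦄ (α β : G), γ = α * β → (C γ →ₗ[k] C α ⊗[k] C β)
  ε : C 1 →ₗ[k] k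
  coassoc : ∀ ⦃δ δ₁ δ₂ : G⦄ (α β γ : G) (h₁ : δ = δ₁ * γ) (h₁' : δ₁ = α * β)
      (h₂ : δ = α * δ₂) (h₂' : δ₂ = β * γ),
      (TensorProduct.assoc k (C α) (C β) (C γ)).toLinearMap ∘ₗ
        (TensorProduct.map (Δ α β h₁') LinearMap.id) ∘ₗ Δ δ₁ γ h₁
      = (TensorProduct.map LinearMap.id (Δ β γ h₂')) ∘ₗ Δ α δ₂ h₂
  counit_right : ∀ (α : G) (h : α = α * 1),
      (TensorProduct.rid k (C α)).toLinearMap ∘ₗ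
        (TensorProduct.map LinearMap.id ε) ∘ₗ Δ α 1 h = LinearMap.id
  counit_left : ∀ (α : G) (h : α = 1 * α),
      (TensorProduct.lid k (C α)).toLinearMap ∘ₗ
        (TensorProduct.map ε LinearMap.id) ∘ₗ Δ 1 α h = LinearMap.id

attribute [instance] GCoalgebra.acg GCoalgebra.mod

variable {k : Type u} [Field k] {G : Type u} [Group G]

/-- A right `G`-`C̲`-comodule. -/
structure GComodule (Cc : GCoalgebra k G) where
  M : G → Type u
  [acg : ∀ α, AddCommGroup (M α)]
  [mod : ∀ α, Module k (M α)]
  ρ : ∀ ⦃γ⦄ (α β : G), γ = α * β → (M γ →ₗ[k] M α ⊗[k] Cc.C β)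
  counit : ∀ (α : G) (h : α = α * 1),
      (TensorProduct.rid k (M α)).toLinearMap ∘ₗ
        (TensorProduct.map LinearMap.id Cc.ε) ∘ₗ ρ α 1 h = LinearMap.id
  coassoc : ∀ ⦃δ δ₁ δ₂ : G⦄ (α β γ : G) (h₁ : δ = δ₁ * γ) (h₁' : δ₁ = α * β)
      (h₂ : δ = α * δ₂) (h₂' : δ₂ = β * γ),
      (TensorProduct.assoc k (M α) (Cc.C β) (Cc.C γ)).toLinearMap ∘ₗ
        (TensorProduct.map (ρ α β h₁') LinearMap.id) ∘ₗ ρ δ₁ γ h₁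
      = (TensorProduct.map LinearMap.id (Cc.Δ β γ h₂')) ∘ₗ ρ α δ₂ h₂

attribute [instance] GComodule.acg GComodule.mod

/-- A morphism of right `G`-`C̲`-comodules. -/
structure GComodHom {Cc : GCoalgebra k G} (M N : GComodule Cc) where
  φ : ∀ α, M.M α →ₗ[k] N.M α
  colinear : ∀ ⦃γ⦄ (α β : G) (h : γ = α * β),
      (TensorProduct.map (φ α) LinearMap.id) ∘ₗ M.ρ α β h = N.ρ α β h ∘ₗ φ γ

/-- A `G`-coalgebra is strong if all comultiplication maps are injective. -/
def GCoalgebra.Strong (Cc : GCoalgebra k G) : Prop :=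
  ∀ (α β : G), Function.Injective (Cc.Δ α β rfl)
section Convolution

variable (k : Type u) [Field k] (C : Type u) [AddCommGroup C] [Module k C]
  [Coalgebra k C]

/-- Convolution of two functionals on a coalgebra: `(f * g)(c) = f(c₁) g(c₂)`. -/
noncomputable def convF (f g : C →ₗ[k] k) : C →ₗ[k] k :=
  LinearMap.mul' k k ∘ₗ TensorProduct.map f g ∘ₗ Coalgebra.comul

/-- `convFM f T : c ↦ f(c₁) T(c₂)`. -/
noncomputable def convFM (f : C →ₗ[k] k) (T : C →ₗ[k] C) : C →ₗ[k] C :=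
  (TensorProduct.lid k C).toLinearMap ∘ₗ TensorProduct.map f T ∘ₗ Coalgebra.comul

/-- `convMF T f : c ↦ T(c₁) f(c₂)`. -/
noncomputable def convMF (T : C →ₗ[k] C) (f : C →ₗ[k] k) : C →ₗ[k] C :=
  (TensorProduct.rid k C).toLinearMap ∘ₗ TensorProduct.map T f ∘ₗ Coalgebra.comul

end Convolution

/-- The data of a crossed coproduct: a `k`-coalgebra `C`, a family of coalgebra
endomorphisms `λ_α` of `C` (a weak `G`-action), and families of functionals
`f_{α,β}, g_{α,β} ∈ C*` (`g` recording the convolution inverses of `f`). -/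
structure CrossedData (k G : Type u) [Field k] [Group G] where
  C : Type u
  [acg : AddCommGroup C]
  [mod : Module k C]
  [coalg : Coalgebra k C]
  lam : G → (C →ₗc[k] C)
  f : G → G → (C →ₗ[k] k)
  g : G → G → (C →ₗ[k] k)

attribute [instance] CrossedData.acg CrossedData.mod CrossedData.coalg

namespace CrossedData

variable {k G : Type u} [Field k] [Group G] (D : CrossedData k G)

/-- `f_{e,e}` and `g_{e,e}` are convolution inverse to each other, and
`λ_e(c) = f_{e,e}(c₁) c₂ g_{e,e}(c₃)`. -/
def IsWeakData : Prop :=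
  convF k D.C (D.f 1 1) (D.g 1 1) = Coalgebra.counit ∧
  convF k D.C (D.g 1 1) (D.f 1 1) = Coalgebra.counit ∧
  (D.lam 1).toLinearMap =
    convMF k D.C (convFM k D.C (D.f 1 1) LinearMap.id) (D.g 1 1)

/-- Condition (CU): `f_{e,α} = f_{e,e}` and `f_{α,e} = f_{e,e} ∘ λ_α`. -/
def CondCU : Prop :=
  ∀ α : G, D.f 1 α = D.f 1 1 ∧ D.f α 1 = D.f 1 1 ∘ₗ (D.lam α).toLinearMap

/-- Condition (C), the cocycle condition:
`f_{β,γ}(λ_α(c₁)) f_{α,βγ}(c₂) = f_{α,β}(c₁) f_{αβ,γ}(c₂)`. -/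
def CondC : Prop :=
  ∀ α β γ : G,
    convF k D.C (D.f β γ ∘ₗ (D.lam α).toLinearMap) (D.f α (β * γ)) =
      convF k D.C (D.f α β) (D.f (α * β) γ)

/-- Condition (TC), the twisted-commutation condition:
`λ_β(λ_α(c₁)) f_{α,β}(c₂) = f_{α,β}(c₁) λ_{αβ}(c₂)`. -/
def CondTC : Prop :=
  ∀ α β : G,
    convMF k D.C ((D.lam β).toLinearMap ∘ₗ (D.lam α).toLinearMap) (D.f α β) =
      convFM k D.C (D.f α β) (D.lam (α * β)).toLinearMap

/-- `f` is a factor set: all `f_{α,β}` are convolution invertible (with inverses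
`g_{α,β}`) and the conditions of Proposition 3.1 hold. -/
def IsFactorSet : Prop :=
  D.IsWeakData ∧
  (∀ α β : G, convF k D.C (D.f α β) (D.g α β) = Coalgebra.counit ∧
    convF k D.C (D.g α β) (D.f α β) = Coalgebra.counit) ∧
  D.CondCU ∧ D.CondC ∧ D.CondTC

/-- `f` is normalized: `f_{α,e} = f_{e,α} = ε_C`. -/
def Normalized : Prop :=
  ∀ α : G, D.f α 1 = Coalgebra.counit ∧ D.f 1 α = Coalgebra.counit

/-- The comultiplication `δ_{α,β} : C → C ⊗ C` of the crossed coproduct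
`C ⋊_f k⟨G⟩` (identifying `C ⋊ p_α` with `C`):
`δ_{α,β}(c) = c₁ ⊗ λ_α(c₂) f_{α,β}(c₃)`. -/
noncomputable def delta (α β : G) : D.C →ₗ[k] D.C ⊗[k] D.C :=
  TensorProduct.map LinearMap.id
      (convMF k D.C (D.lam α).toLinearMap (D.f α β)) ∘ₗ Coalgebra.comul

/-- The `G`-coalgebra axioms for the (constant) family `C ⋊ p_α ≅ C` with the
crossed-coproduct structure maps `δ_{α,β}` and counit `g_{e,e}`. -/
def IsGCoalgebra : Prop :=
  (∀ α β γ : G,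
    (TensorProduct.assoc k D.C D.C D.C).toLinearMap ∘ₗ
      (TensorProduct.map (D.delta α β) LinearMap.id) ∘ₗ D.delta (α * β) γ
    = (TensorProduct.map LinearMap.id (D.delta β γ)) ∘ₗ D.delta α (β * γ)) ∧
  (∀ α : G,
    (TensorProduct.rid k D.C).toLinearMap ∘ₗ
      (TensorProduct.map LinearMap.id (D.g 1 1)) ∘ₗ D.delta α 1 = LinearMap.id) ∧
  (∀ α : G,
    (TensorProduct.lid k D.C).toLinearMap ∘ₗ
      (TensorProduct.map (D.g 1 1) LinearMap.id) ∘ₗ D.delta 1 α = LinearMap.id)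

end CrossedData
/-- A `G`-coalgebra `C̲` is cocleft if there is a convolution invertible morphism
`u̲ : C̲ → k⟨G⟩` in `(M_k)^G`, i.e. functionals `u_α ∈ C_α*` and `v_α ∈ C_{α⁻¹}*`
with `u_α(c_{(1,α)}) v_α(c_{(2,α⁻¹)}) = v_α(c_{(1,α⁻¹)}) u_α(c_{(2,α)}) = ε(c)`
for all `c ∈ C_e`. -/
def GCoalgebra.Cocleft {k G : Type u} [Field k] [Group G] (Cc : GCoalgebra k G) : Prop :=
  ∃ (u : ∀ α : G, Cc.C α →ₗ[k] k) (v : ∀ α : G, Cc.C α⁻¹ →ₗ[k] k),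
    ∀ α : G,
      LinearMap.mul' k k ∘ₗ TensorProduct.map (u α) (v α) ∘ₗ
          Cc.Δ α α⁻¹ (mul_inv_cancel α).symm = Cc.ε ∧
      LinearMap.mul' k k ∘ₗ TensorProduct.map (v α) (u α) ∘ₗ
          Cc.Δ α⁻¹ α (inv_mul_cancel α).symm = Cc.ε

/-- `C̲` is isomorphic, as a `G`-coalgebra, to the crossed coproduct `C ⋊_f k⟨G⟩`
determined by the crossed data `D`. -/
def IsoToCrossed {k G : Type u} [Field k] [Group G] (Cc : GCoalgebra k G)
    (D : CrossedData k G) : Prop :=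
  ∃ φ : ∀ α : G, Cc.C α ≃ₗ[k] D.C,
    (D.g 1 1 ∘ₗ (φ 1).toLinearMap = Cc.ε) ∧
    ∀ ⦃γ : G⦄ (α β : G) (h : γ = α * β),
      TensorProduct.map (φ α).toLinearMap (φ β).toLinearMap ∘ₗ Cc.Δ α β h
        = D.delta α β ∘ₗ (φ γ).toLinearMap

/-- `C_α` is isomorphic to `C_e` as a left `C_e`-comodule (left coactions `Δ_{e,α}`
and `Δ_{e,e}`). -/
def LeftCeIso {k G : Type u} [Field k] [Group G] (Cc : GCoalgebra k G) (α : G) : Prop :=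
  ∃ φ : Cc.C α ≃ₗ[k] Cc.C 1,
    Cc.Δ 1 1 (one_mul 1).symm ∘ₗ φ.toLinearMap
      = TensorProduct.map LinearMap.id φ.toLinearMap ∘ₗ Cc.Δ 1 α (one_mul α).symm

/-- A linear map into a vector space is determined by its composites with functionals. -/
theorem LinearMap.ext_of_dual {k V W : Type*} [Field k] [AddCommGroup V] [Module k V]
    [AddCommGroup W] [Module k W] {S T : V →ₗ[k] W}
    (h : ∀ a : W →ₗ[k] k, a ∘ₗ S = a ∘ₗ T) : S = T := by
  ext x
  rw [← sub_eq_zero, ← Module.forall_dual_apply_eq_zero_iff k]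
  intro a
  rw [map_sub, sub_eq_zero]
  exact LinearMap.congr_fun (h a) x

/-- A linear map into a tensor product of vector spaces is determined by its composites with
pure tensors of functionals. -/
theorem LinearMap.ext_of_dual_tmul {k V W W' : Type*} [Field k] [AddCommGroup V] [Module k V]
    [AddCommGroup W] [Module k W] [AddCommGroup W'] [Module k W'] {S T : V →ₗ[k] W ⊗[k] W'}
    (h : ∀ (a : W →ₗ[k] k) (b : W' →ₗ[k] k),
      LinearMap.mul' k k ∘ₗ TensorProduct.map a b ∘ₗ S =
        LinearMap.mul' k k ∘ₗ TensorProduct.map a b ∘ₗ T) : S = T := by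
  let b := Module.Basis.ofVectorSpace k W
  let c := Module.Basis.ofVectorSpace k W'
  have key : ∀ i j, (b.tensorProduct c).coord (i, j) =
      LinearMap.mul' k k ∘ₗ TensorProduct.map (b.coord i) (c.coord j) := by
    intro i j
    ext x y
    simp [mul_comm]
  ext x
  refine (b.tensorProduct c).ext_elem fun ⟨i, j⟩ => ?_
  have := LinearMap.congr_fun (h (b.coord i) (c.coord j)) x
  rw [← LinearMap.comp_assoc, ← LinearMap.comp_assoc, ← key] at this
  exact this

section Convolution

variable {k C : Type u} [Field k] [AddCommGroup C] [Module k C] [Coalgebra k C]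

theorem comp_convFM (a f : C →ₗ[k] k) (T : C →ₗ[k] C) :
    a ∘ₗ convFM k C f T = convF k C f (a ∘ₗ T) := by
  have : a ∘ₗ (TensorProduct.lid k C).toLinearMap ∘ₗ TensorProduct.map f T =
      LinearMap.mul' k k ∘ₗ TensorProduct.map f (a ∘ₗ T) := by
    ext x y
    simp
  simpa only [LinearMap.comp_assoc, convFM, convF] using congrArg (· ∘ₗ Coalgebra.comul) this

theorem comp_convMF (a f : C →ₗ[k] k) (T : C →ₗ[k] C) :
    a ∘ₗ convMF k C T f = convF k C (a ∘ₗ T) f := by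
  have : a ∘ₗ (TensorProduct.rid k C).toLinearMap ∘ₗ TensorProduct.map T f =
      LinearMap.mul' k k ∘ₗ TensorProduct.map (a ∘ₗ T) f := by
    ext x y
    simp [mul_comm]
  simpa only [LinearMap.comp_assoc, convMF, convF] using congrArg (· ∘ₗ Coalgebra.comul) this

theorem toConv_convF (a b : C →ₗ[k] k) :
    WithConv.toConv (convF k C a b) = WithConv.toConv a * WithConv.toConv b :=
  rfl

theorem toConv_counit : WithConv.toConv (Coalgebra.counit : C →ₗ[k] k) = 1 :=
  rfl

end Convolution

namespace CrossedData

variable {k G : Type u} [Field k] [Group G] (D : CrossedData k G)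

theorem mul'_map_comp_delta (α β : G) (a b : D.C →ₗ[k] k) :
    LinearMap.mul' k k ∘ₗ TensorProduct.map a b ∘ₗ D.delta α β =
      convF k D.C a (convF k D.C (b ∘ₗ (D.lam α).toLinearMap) (D.f α β)) := by
  rw [← comp_convMF, delta, ← LinearMap.comp_assoc _ _ (TensorProduct.map a b),
    ← TensorProduct.map_comp, LinearMap.comp_id, convF]

variable {D} in
/-- A `G`-coalgebra isomorphic to a crossed coproduct is cocleft. -/
theorem IsFactorSet.cocleft (hD : D.IsFactorSet) {Cc : GCoalgebra k G}
    (hiso : IsoToCrossed Cc D) : Cc.Cocleft := by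
  obtain ⟨-, hfg, hCU, hC, -⟩ := hD
  obtain ⟨φ, hε, hφ⟩ := hiso
  have key : ∀ {α β : G} (h : 1 = α * β) (a b : D.C →ₗ[k] k),
      convF k D.C a (convF k D.C (b ∘ₗ (D.lam α).toLinearMap) (D.f α β)) = D.g 1 1 →
      LinearMap.mul' k k ∘ₗ TensorProduct.map (a ∘ₗ (φ α).toLinearMap)
        (b ∘ₗ (φ β).toLinearMap) ∘ₗ Cc.Δ α β h = Cc.ε := by
    intro α β h a b hab
    rw [TensorProduct.map_comp, LinearMap.comp_assoc, hφ, ← LinearMap.comp_assoc (φ 1).toLinearMap,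
      ← LinearMap.comp_assoc, mul'_map_comp_delta, hab, hε]
  refine ⟨fun α => Coalgebra.counit ∘ₗ (φ α).toLinearMap,
    fun α => convF k D.C (D.g 1 1) (D.g α⁻¹ α) ∘ₗ (φ α⁻¹).toLinearMap,
    fun α => ⟨key _ _ _ ?_, key _ _ _ ?_⟩⟩ <;> apply WithConv.toConv_injective
  · have hcomp : ∀ a b : D.C →ₗ[k] k, WithConv.toConv
        (convF k D.C a b ∘ₗ (D.lam α).toLinearMap) =
          WithConv.toConv (a ∘ₗ (D.lam α).toLinearMap) *
            WithConv.toConv (b ∘ₗ (D.lam α).toLinearMap) := fun a b =>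
      congrArg WithConv.toConv (LinearMap.convMul_comp_coalgHom_distrib
        (WithConv.toConv a) (WithConv.toConv b) (D.lam α))
    have hinv : ∀ β γ : G, WithConv.toConv (D.g β γ ∘ₗ (D.lam α).toLinearMap) *
        WithConv.toConv (D.f β γ ∘ₗ (D.lam α).toLinearMap) = 1 := by
      intro β γ
      rw [← hcomp, (hfg β γ).2, (D.lam α).counit_comp, toConv_counit]
    have hE : WithConv.toConv (D.f 1 1) * WithConv.toConv (D.g 1 1) = 1 := by
      rw [← toConv_convF, (hfg 1 1).1, toConv_counit]
    have hc := congrArg WithConv.toConv (hC α α⁻¹ α)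
    rw [mul_inv_cancel, inv_mul_cancel, (hCU α).1, (hCU α).2, toConv_convF, toConv_convF] at hc
    rw [toConv_convF, toConv_convF, toConv_counit, one_mul, hcomp]
    rw [← mul_one (WithConv.toConv (D.f α α⁻¹)), ← hE, ← mul_assoc (WithConv.toConv (D.f α α⁻¹)),
      ← hc, mul_assoc, mul_assoc, ← mul_assoc (WithConv.toConv (D.g α⁻¹ α ∘ₗ _)), hinv, one_mul,
      ← mul_assoc, hinv, one_mul]
  · rw [toConv_convF, toConv_convF, toConv_convF, (D.lam α⁻¹).counit_comp, toConv_counit, one_mul,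
      mul_assoc, ← toConv_convF (D.g α⁻¹ α), (hfg α⁻¹ α).2, toConv_counit, mul_one]

end CrossedData

namespace GCoalgebra

variable {k G : Type u} [Field k] [Group G] (Cc : GCoalgebra k G) {α β γ : G}

/-- The convolution product `C_α* × C_β* → C_{αβ}*`. -/
noncomputable def conv (h : γ = α * β) (a : Cc.C α →ₗ[k] k) (b : Cc.C β →ₗ[k] k) :
    Cc.C γ →ₗ[k] k :=
  LinearMap.mul' k k ∘ₗ TensorProduct.map a b ∘ₗ Cc.Δ α β h

/-- The map `c ↦ c_{(1,α)} b(c_{(2,β)})`. -/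
noncomputable def contractRight (h : γ = α * β) (b : Cc.C β →ₗ[k] k) : Cc.C γ →ₗ[k] Cc.C α :=
  (TensorProduct.rid k _).toLinearMap ∘ₗ TensorProduct.map LinearMap.id b ∘ₗ Cc.Δ α β h

/-- The map `c ↦ a(c_{(1,α)}) c_{(2,β)}`. -/
noncomputable def contractLeft (h : γ = α * β) (a : Cc.C α →ₗ[k] k) : Cc.C γ →ₗ[k] Cc.C β :=
  (TensorProduct.lid k _).toLinearMap ∘ₗ TensorProduct.map a LinearMap.id ∘ₗ Cc.Δ α β h

theorem comp_contractRight (h : γ = α * β) (a : Cc.C α →ₗ[k] k) (b : Cc.C β →ₗ[k] k) :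
    a ∘ₗ Cc.contractRight h b = Cc.conv h a b := by
  have : a ∘ₗ (TensorProduct.rid k _).toLinearMap ∘ₗ TensorProduct.map LinearMap.id b =
      LinearMap.mul' k k ∘ₗ TensorProduct.map a b := by
    ext x y
    simp [mul_comm]
  simpa only [LinearMap.comp_assoc, contractRight, conv] using congrArg (· ∘ₗ Cc.Δ α β h) this

theorem comp_contractLeft (h : γ = α * β) (a : Cc.C α →ₗ[k] k) (b : Cc.C β →ₗ[k] k) :
    b ∘ₗ Cc.contractLeft h a = Cc.conv h a b := by
  have : b ∘ₗ (TensorProduct.lid k _).toLinearMap ∘ₗ TensorProduct.map a LinearMap.id =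
      LinearMap.mul' k k ∘ₗ TensorProduct.map a b := by
    ext x y
    simp
  simpa only [LinearMap.comp_assoc, contractLeft, conv] using congrArg (· ∘ₗ Cc.Δ α β h) this

theorem conv_counit (h : α = α * 1) (a : Cc.C α →ₗ[k] k) : Cc.conv h a Cc.ε = a := by
  rw [← comp_contractRight, contractRight, Cc.counit_right, LinearMap.comp_id]

theorem counit_conv (h : α = 1 * α) (a : Cc.C α →ₗ[k] k) : Cc.conv h Cc.ε a = a := by
  rw [← comp_contractLeft, contractLeft, Cc.counit_left, LinearMap.comp_id]

theorem conv_assoc {δ δ₁ δ₂ : G} (h₁ : δ = δ₁ * γ) (h₁' : δ₁ = α * β) (h₂ : δ = α * δ₂)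
    (h₂' : δ₂ = β * γ) (a : Cc.C α →ₗ[k] k) (b : Cc.C β →ₗ[k] k) (c : Cc.C γ →ₗ[k] k) :
    Cc.conv h₁ (Cc.conv h₁' a b) c = Cc.conv h₂ a (Cc.conv h₂' b c) := by
  let m : Cc.C α ⊗[k] (Cc.C β ⊗[k] Cc.C γ) →ₗ[k] k :=
    LinearMap.mul' k k ∘ₗ TensorProduct.map a (LinearMap.mul' k k ∘ₗ TensorProduct.map b c)
  have l : m ∘ₗ (TensorProduct.assoc k (Cc.C α) (Cc.C β) (Cc.C γ)).toLinearMap =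
      LinearMap.mul' k k ∘ₗ
        TensorProduct.map (LinearMap.mul' k k ∘ₗ TensorProduct.map a b) c := by
    ext x y z
    simp [m, mul_assoc]
  have l' : m ∘ₗ (TensorProduct.assoc k (Cc.C α) (Cc.C β) (Cc.C γ)).toLinearMap ∘ₗ
      TensorProduct.map (Cc.Δ α β h₁') LinearMap.id =
        LinearMap.mul' k k ∘ₗ TensorProduct.map (Cc.conv h₁' a b) c := by
    rw [← LinearMap.comp_assoc, l, LinearMap.comp_assoc, ← TensorProduct.map_comp,
      LinearMap.comp_id, LinearMap.comp_assoc, conv]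
  have r : m ∘ₗ TensorProduct.map LinearMap.id (Cc.Δ β γ h₂') =
      LinearMap.mul' k k ∘ₗ TensorProduct.map a (Cc.conv h₂' b c) := by
    rw [LinearMap.comp_assoc, ← TensorProduct.map_comp, LinearMap.comp_id, LinearMap.comp_assoc,
      conv]
  rw [conv, ← LinearMap.comp_assoc, ← l', LinearMap.comp_assoc, LinearMap.comp_assoc (Cc.Δ δ₁ γ h₁),
    Cc.coassoc α β γ h₁ h₁' h₂ h₂', ← LinearMap.comp_assoc, r, LinearMap.comp_assoc, ← conv]

/-- Homogeneous functionals on `C̲`, i.e. functionals on one of the components. -/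
def Functional : Type u := Σ α : G, Cc.C α →ₗ[k] k

/-- A functional on `C_α`, as a homogeneous functional. -/
def functional (α : G) (a : Cc.C α →ₗ[k] k) : Cc.Functional := ⟨α, a⟩

theorem functional_injective (α : G) : Function.Injective (Cc.functional α) :=
  fun _ _ h => eq_of_heq (Sigma.mk.inj h).2

theorem exists_functional_eq (m : Cc.Functional) (h : m.1 = α) :
    ∃ a, Cc.functional α a = m := by
  subst h
  exact ⟨m.2, rfl⟩

noncomputable instance : Mul Cc.Functional := ⟨fun a b => ⟨a.1 * b.1, Cc.conv rfl a.2 b.2⟩⟩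

instance : One Cc.Functional := ⟨⟨1, Cc.ε⟩⟩

theorem functional_counit : Cc.functional 1 Cc.ε = 1 := rfl

theorem functional_conv (h : γ = α * β) (a : Cc.C α →ₗ[k] k) (b : Cc.C β →ₗ[k] k) :
    Cc.functional γ (Cc.conv h a b) = Cc.functional α a * Cc.functional β b := by
  subst h
  rfl

/-- Homogeneous functionals form a monoid under convolution. -/
noncomputable instance : Monoid Cc.Functional where
  mul_assoc := by
    rintro ⟨α, a⟩ ⟨β, b⟩ ⟨γ, c⟩
    change Cc.functional _ a * Cc.functional _ b * Cc.functional _ c =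
      Cc.functional _ a * (Cc.functional _ b * Cc.functional _ c)
    rw [← Cc.functional_conv rfl, ← Cc.functional_conv rfl, ← Cc.functional_conv rfl,
      ← Cc.functional_conv (mul_assoc α β γ), Cc.conv_assoc]
  one_mul := by
    rintro ⟨α, a⟩
    change Cc.functional _ Cc.ε * Cc.functional _ a = Cc.functional _ a
    rw [← Cc.functional_conv (one_mul α).symm, counit_conv]
  mul_one := by
    rintro ⟨α, a⟩
    change Cc.functional _ a * Cc.functional _ Cc.ε = Cc.functional _ a
    rw [← Cc.functional_conv (mul_one α).symm, conv_counit]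

theorem functional_comp_contractRight (h : γ = α * β) (a : Cc.C α →ₗ[k] k)
    (b : Cc.C β →ₗ[k] k) :
    Cc.functional γ (a ∘ₗ Cc.contractRight h b) = Cc.functional α a * Cc.functional β b := by
  rw [comp_contractRight, functional_conv]

theorem functional_comp_contractLeft (h : γ = α * β) (a : Cc.C α →ₗ[k] k)
    (b : Cc.C β →ₗ[k] k) :
    Cc.functional γ (b ∘ₗ Cc.contractLeft h a) = Cc.functional α a * Cc.functional β b := by
  rw [comp_contractLeft, functional_conv]

/-- Testing a composite of `Δ_{α,β}` with a tensor product of linear maps against a pure tensor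
of functionals gives a convolution product. -/
theorem mul'_map_comp_map_comp_comul {V W : Type u} [AddCommGroup V] [Module k V]
    [AddCommGroup W] [Module k W] (h : γ = α * β) (S : Cc.C α →ₗ[k] V) (T : Cc.C β →ₗ[k] W)
    (a : V →ₗ[k] k) (b : W →ₗ[k] k) :
    LinearMap.mul' k k ∘ₗ TensorProduct.map a b ∘ₗ TensorProduct.map S T ∘ₗ Cc.Δ α β h =
      Cc.conv h (a ∘ₗ S) (b ∘ₗ T) := by
  rw [conv, TensorProduct.map_comp, LinearMap.comp_assoc]

/-- Mutually inverse functionals `u`, `v` of degrees `α`, `β` induce an isomorphism `C_α ≃ C_e`,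
given by `c ↦ c_{(1,e)} u(c_{(2,α)})`. -/
noncomputable def equivOfInverse (h : 1 = α * β) {u : Cc.C α →ₗ[k] k} {v : Cc.C β →ₗ[k] k}
    (huv : Cc.functional α u * Cc.functional β v = 1)
    (hvu : Cc.functional β v * Cc.functional α u = 1) : Cc.C α ≃ₗ[k] Cc.C 1 :=
  LinearEquiv.ofLinearMap (Cc.contractRight (one_mul α).symm u) (Cc.contractRight h v)
    (LinearMap.ext_of_dual fun a => Cc.functional_injective _ <| by
      rw [← LinearMap.comp_assoc, functional_comp_contractRight, functional_comp_contractRight,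
        mul_assoc, huv, mul_one, LinearMap.comp_id])
    (LinearMap.ext_of_dual fun a => Cc.functional_injective _ <| by
      rw [← LinearMap.comp_assoc, functional_comp_contractRight, functional_comp_contractRight,
        mul_assoc, hvu, mul_one, LinearMap.comp_id])

variable {Cc} in
theorem cocleft_iff : Cc.Cocleft ↔ ∃ u : ∀ α : G, Cc.C α →ₗ[k] k, ∀ α : G,
    ∃ v : Cc.C α⁻¹ →ₗ[k] k, Cc.functional α (u α) * Cc.functional α⁻¹ v = 1 ∧
      Cc.functional α⁻¹ v * Cc.functional α (u α) = 1 := by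
  have key : ∀ {α β : G} (h : 1 = α * β) (a : Cc.C α →ₗ[k] k) (b : Cc.C β →ₗ[k] k),
      LinearMap.mul' k k ∘ₗ TensorProduct.map a b ∘ₗ Cc.Δ α β h = Cc.ε ↔
        Cc.functional α a * Cc.functional β b = 1 := by
    intro α β h a b
    rw [← Cc.functional_conv h, ← functional_counit, (Cc.functional_injective 1).eq_iff, conv]
  simp only [Cocleft, key]
  constructor
  · rintro ⟨u, v, h⟩
    exact ⟨u, fun α => ⟨v α, h α⟩⟩
  · rintro ⟨u, h⟩
    choose v h using h
    exact ⟨u, v, h⟩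

variable {Cc} in
/-- The functionals of a cocleft `G`-coalgebra can be chosen with `u_e = ε`. -/
theorem Cocleft.exists_normalized (hc : Cc.Cocleft) : ∃ u : ∀ α : G, Cc.C α →ₗ[k] k,
    u 1 = Cc.ε ∧ ∀ α : G, ∃ v : Cc.C α⁻¹ →ₗ[k] k,
      Cc.functional α (u α) * Cc.functional α⁻¹ v = 1 ∧
        Cc.functional α⁻¹ v * Cc.functional α (u α) = 1 := by
  classical
  obtain ⟨u, hu⟩ := cocleft_iff.1 hc
  refine ⟨Function.update u 1 Cc.ε, Function.update_self .., fun α => ?_⟩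
  by_cases hα : α = 1
  · subst hα
    obtain ⟨v, hv⟩ := Cc.exists_functional_eq (α := 1⁻¹) 1 inv_one.symm
    exact ⟨v, by simp [hv, functional_counit]⟩
  · rw [Function.update_of_ne hα]
    exact hu α

variable {Cc} in
theorem Cocleft.strong (hc : Cc.Cocleft) : Cc.Strong := by
  obtain ⟨u, hu⟩ := cocleft_iff.1 hc
  intro α β
  rw [injective_iff_map_eq_zero]
  intro c hc
  rw [← Module.forall_dual_apply_eq_zero_iff k]
  intro a
  obtain ⟨v, -, hv⟩ := hu β
  have hd : (Cc.functional _ a * Cc.functional β⁻¹ v).1 = α := mul_inv_cancel_right α β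
  obtain ⟨a', ha'⟩ := Cc.exists_functional_eq _ hd
  have : a = Cc.conv rfl a' (u β) := by
    apply Cc.functional_injective
    rw [functional_conv, ha', mul_assoc, hv, mul_one]
  rw [this]
  simp [conv, hc]

variable {Cc} in
theorem Cocleft.leftCeIso (hc : Cc.Cocleft) (α : G) : LeftCeIso Cc α := by
  obtain ⟨u, hu⟩ := cocleft_iff.1 hc
  obtain ⟨v, huv, hvu⟩ := hu α
  refine ⟨Cc.equivOfInverse (mul_inv_cancel α).symm huv hvu,
    LinearMap.ext_of_dual_tmul fun a b => Cc.functional_injective _ ?_⟩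
  rw [mul'_map_comp_map_comp_comul, ← LinearMap.comp_assoc, ← LinearMap.comp_assoc,
    LinearMap.comp_assoc _ (TensorProduct.map a b), functional_conv]
  change Cc.functional α (Cc.conv _ a b ∘ₗ Cc.contractRight _ _) =
    _ * Cc.functional α (b ∘ₗ Cc.contractRight _ _)
  rw [functional_comp_contractRight, functional_comp_contractRight, functional_conv, mul_assoc,
    LinearMap.comp_id]

variable {Cc} in
/-- A left `C_e`-colinear map `C_α → C_e` is `c ↦ c_{(1,e)} u(c_{(2,α)})` with `u = ε ∘ φ`. -/
theorem functional_comp_of_colinear {φ : Cc.C α →ₗ[k] Cc.C 1}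
    (hφ : Cc.Δ 1 1 (one_mul 1).symm ∘ₗ φ =
      TensorProduct.map LinearMap.id φ ∘ₗ Cc.Δ 1 α (one_mul α).symm) (a : Cc.C 1 →ₗ[k] k) :
    Cc.functional α (a ∘ₗ φ) = Cc.functional 1 a * Cc.functional α (Cc.ε ∘ₗ φ) := by
  rw [← Cc.functional_conv (one_mul α).symm, ← a.comp_id, ← mul'_map_comp_map_comp_comul, ← hφ,
    LinearMap.comp_id]
  conv_lhs => rw [← Cc.conv_counit (one_mul 1).symm a, GCoalgebra.conv]
  simp only [LinearMap.comp_assoc]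

variable {Cc} in
theorem Strong.cocleft (hs : Cc.Strong) (hiso : ∀ α : G, LeftCeIso Cc α) : Cc.Cocleft := by
  choose φ hφ using hiso
  refine cocleft_iff.2 ⟨fun α => Cc.ε ∘ₗ (φ α).toLinearMap, fun α => ?_⟩
  set u := Cc.ε ∘ₗ (φ α).toLinearMap
  have hcomp := functional_comp_of_colinear (hφ α)
  have hone : (1 : G) = α⁻¹ * α := (inv_mul_cancel α).symm
  have hinj : Function.Injective (Cc.Δ α⁻¹ α hone) := by
    have : ∀ γ (h : γ = α⁻¹ * α), Function.Injective (Cc.Δ α⁻¹ α h) := by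
      rintro _ rfl
      exact hs _ _
    exact this _ _
  obtain ⟨r, hr⟩ := LinearMap.exists_leftInverse_of_injective _ (LinearMap.ker_eq_bot.2 hinj)
  let T : Cc.C α⁻¹ →ₗ[k] Cc.C α⁻¹ ⊗[k] Cc.C α :=
    TensorProduct.map LinearMap.id (φ α).symm.toLinearMap ∘ₗ Cc.Δ α⁻¹ 1 (mul_one _).symm
  have hT : (TensorProduct.rid k _).toLinearMap ∘ₗ TensorProduct.map T u ∘ₗ Cc.Δ α⁻¹ α hone =
      Cc.Δ α⁻¹ α hone := by
    refine LinearMap.ext_of_dual_tmul fun a b => Cc.functional_injective _ ?_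
    have e : LinearMap.mul' k k ∘ₗ TensorProduct.map a b ∘ₗ (TensorProduct.rid k _).toLinearMap ∘ₗ
        TensorProduct.map T u = LinearMap.mul' k k ∘ₗ
          TensorProduct.map (LinearMap.mul' k k ∘ₗ TensorProduct.map a b ∘ₗ T) u := by
      ext x y
      simp [mul_comm]
    have e' : LinearMap.mul' k k ∘ₗ TensorProduct.map a b ∘ₗ
        (TensorProduct.rid k _).toLinearMap ∘ₗ TensorProduct.map T u ∘ₗ Cc.Δ α⁻¹ α hone =
        Cc.conv hone (Cc.conv (mul_one _).symm a (b ∘ₗ (φ α).symm.toLinearMap)) u := by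
      have := congrArg (· ∘ₗ Cc.Δ α⁻¹ α hone) e
      rw [mul'_map_comp_map_comp_comul] at this
      simpa only [LinearMap.comp_assoc, LinearMap.comp_id, GCoalgebra.conv] using this
    rw [e', functional_conv, functional_conv, mul_assoc, ← hcomp, LinearMap.comp_assoc,
      LinearEquiv.symm_comp, LinearMap.comp_id, ← Cc.functional_conv hone, GCoalgebra.conv]
  let v : Cc.C α⁻¹ →ₗ[k] k := Cc.ε ∘ₗ r ∘ₗ T
  have hvu : Cc.functional α⁻¹ v * Cc.functional α u = 1 := by
    have e : Cc.conv hone v u = Cc.ε ∘ₗ r ∘ₗ (TensorProduct.rid k _).toLinearMap ∘ₗ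
        TensorProduct.map T u ∘ₗ Cc.Δ α⁻¹ α hone := by
      have : LinearMap.mul' k k ∘ₗ TensorProduct.map v u = Cc.ε ∘ₗ r ∘ₗ
          (TensorProduct.rid k _).toLinearMap ∘ₗ TensorProduct.map T u := by
        ext x y
        simp [v, mul_comm]
      simpa only [LinearMap.comp_assoc, GCoalgebra.conv] using congrArg (· ∘ₗ Cc.Δ α⁻¹ α hone) this
    rw [← Cc.functional_conv hone, e, hT, hr, LinearMap.comp_id, functional_counit]
  refine ⟨v, ?_, hvu⟩
  have hone' : (1 : G) = α * α⁻¹ := (mul_inv_cancel α).symm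
  have hsymm : Cc.contractRight hone' v = (φ α).symm.toLinearMap := by
    have : Cc.contractRight hone' v ∘ₗ (φ α).toLinearMap = LinearMap.id :=
      LinearMap.ext_of_dual fun a => Cc.functional_injective _ <| by
        rw [← LinearMap.comp_assoc, hcomp, functional_comp_contractRight, mul_assoc, hvu, mul_one,
          LinearMap.comp_id]
    rw [← LinearMap.comp_id (Cc.contractRight hone' v), ← LinearEquiv.comp_symm (φ α),
      ← LinearMap.comp_assoc, this, LinearMap.id_comp]
  rw [← Cc.functional_comp_contractRight hone', hsymm, LinearMap.comp_assoc,
    LinearEquiv.comp_symm, LinearMap.comp_id, functional_counit]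

/-- The component `C_e` is a coalgebra. -/
noncomputable instance : Coalgebra k (Cc.C 1) where
  comul := Cc.Δ 1 1 (one_mul 1).symm
  counit := Cc.ε
  coassoc := Cc.coassoc 1 1 1 _ _ _ _
  rTensor_counit_comp_comul := LinearMap.ext fun c => (TensorProduct.lid k (Cc.C 1)).injective <|
    (LinearMap.congr_fun (Cc.counit_left 1 (one_mul 1).symm) c).trans (by simp)
  lTensor_counit_comp_comul := LinearMap.ext fun c => (TensorProduct.rid k (Cc.C 1)).injective <|
    (LinearMap.congr_fun (Cc.counit_right 1 (one_mul 1).symm) c).trans (by simp)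

theorem functional_coalgebra_counit : Cc.functional 1 Coalgebra.counit = 1 := rfl

theorem functional_convF (a b : Cc.C 1 →ₗ[k] k) :
    Cc.functional 1 (convF k (Cc.C 1) a b) = Cc.functional 1 a * Cc.functional 1 b :=
  Cc.functional_conv (one_mul 1).symm a b

theorem functional_comp_convFM (a f : Cc.C 1 →ₗ[k] k) (T : Cc.C 1 →ₗ[k] Cc.C 1) :
    Cc.functional 1 (a ∘ₗ convFM k (Cc.C 1) f T) =
      Cc.functional 1 f * Cc.functional 1 (a ∘ₗ T) := by
  rw [comp_convFM, functional_convF]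

theorem functional_comp_convMF (a f : Cc.C 1 →ₗ[k] k) (T : Cc.C 1 →ₗ[k] Cc.C 1) :
    Cc.functional 1 (a ∘ₗ convMF k (Cc.C 1) T f) =
      Cc.functional 1 (a ∘ₗ T) * Cc.functional 1 f := by
  rw [comp_convMF, functional_convF]

/-- Conjugation by mutually inverse functionals `u`, `v` of degrees `α`, `β`, as the coalgebra
endomorphism `c ↦ u(c_{(1,α)}) c_{(2,e)} v(c_{(3,β)})` of `C_e`. -/
noncomputable def conjugate (h : 1 = α * β) {u : Cc.C α →ₗ[k] k} {v : Cc.C β →ₗ[k] k}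
    (huv : Cc.functional α u * Cc.functional β v = 1)
    (hvu : Cc.functional β v * Cc.functional α u = 1) : Cc.C 1 →ₗc[k] Cc.C 1 where
  toLinearMap := Cc.contractLeft (mul_one α).symm u ∘ₗ Cc.contractRight h v
  counit_comp := Cc.functional_injective _ <| by
    rw [← LinearMap.comp_assoc, functional_comp_contractRight, functional_comp_contractLeft,
      functional_coalgebra_counit, mul_one, huv]
  map_comp_comul := LinearMap.ext_of_dual_tmul fun a b => Cc.functional_injective _ <| by
    refine (congrArg _ (Cc.mul'_map_comp_map_comp_comul _ _ _ a b)).trans ?_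
    change _ = Cc.functional 1 (Cc.conv (one_mul 1).symm a b ∘ₗ
      Cc.contractLeft (mul_one α).symm u ∘ₗ Cc.contractRight h v)
    simp only [functional_conv, ← LinearMap.comp_assoc, functional_comp_contractRight,
      functional_comp_contractLeft, mul_assoc]
    rw [← mul_assoc (Cc.functional β v) (Cc.functional α u), hvu, one_mul]

theorem functional_comp_conjugate (h : 1 = α * β) {u : Cc.C α →ₗ[k] k} {v : Cc.C β →ₗ[k] k}
    (huv : Cc.functional α u * Cc.functional β v = 1)
    (hvu : Cc.functional β v * Cc.functional α u = 1) (a : Cc.C 1 →ₗ[k] k) :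
    Cc.functional 1 (a ∘ₗ (Cc.conjugate h huv hvu).toLinearMap) =
      Cc.functional α u * Cc.functional 1 a * Cc.functional β v := by
  change Cc.functional 1 (a ∘ₗ Cc.contractLeft _ u ∘ₗ Cc.contractRight h v) = _
  rw [← LinearMap.comp_assoc, functional_comp_contractRight, functional_comp_contractLeft]

variable {Cc} in
/-- A cocleft `G`-coalgebra is isomorphic to a crossed coproduct with normalized factor set
`f_{α,β} = u_α u_β v_{αβ}` and weak action given by conjugation. -/
theorem Cocleft.exists_isoToCrossed (hc : Cc.Cocleft) :
    ∃ D : CrossedData k G, D.IsFactorSet ∧ D.Normalized ∧ IsoToCrossed Cc D := by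
  obtain ⟨u, hu, hv⟩ := hc.exists_normalized
  choose v huv hvu using hv
  have hone : ∀ α : G, 1 = α * α⁻¹ := fun α => (mul_inv_cancel α).symm
  let lam (α : G) : Cc.C 1 →ₗc[k] Cc.C 1 := Cc.conjugate (hone α) (huv α) (hvu α)
  let φ (α : G) : Cc.C α ≃ₗ[k] Cc.C 1 := Cc.equivOfInverse (hone α) (huv α) (hvu α)
  obtain ⟨U, hU⟩ : ∃ U : G → Cc.Functional, ∀ α, Cc.functional α (u α) = U α :=
    ⟨_, fun _ => rfl⟩
  obtain ⟨V, hV⟩ : ∃ V : G → Cc.Functional, ∀ α, Cc.functional α⁻¹ (v α) = V α :=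
    ⟨_, fun _ => rfl⟩
  have hlam : ∀ α a, Cc.functional 1 (a ∘ₗ (lam α).toLinearMap) =
      U α * Cc.functional 1 a * V α := fun α a => by
    rw [← hU, ← hV]
    exact Cc.functional_comp_conjugate _ _ _ a
  have hφ : ∀ α a, Cc.functional α (a ∘ₗ (φ α).toLinearMap) = Cc.functional 1 a * U α :=
    fun α a => by
      rw [← hU]
      exact Cc.functional_comp_contractRight _ a _
  have hf : ∀ α β, ∃ f, Cc.functional 1 f = U α * U β * V (α * β) := fun α β =>
    Cc.exists_functional_eq _ (by
      rw [← hU, ← hU, ← hV]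
      exact mul_inv_cancel (α * β))
  have hg : ∀ α β, ∃ g, Cc.functional 1 g = U (α * β) * V β * V α := fun α β =>
    Cc.exists_functional_eq _ (by
      rw [← hU, ← hV, ← hV]
      change α * β * β⁻¹ * α⁻¹ = 1
      group)
  choose f hf using hf
  choose g hg using hg
  clear_value lam φ
  simp only [hU, hV] at huv hvu
  have hU1 : U 1 = 1 := by rw [← hU, hu, functional_counit]
  have hV1 : V 1 = 1 := by simpa [hU1] using huv 1
  have huv' : ∀ α x, U α * (V α * x) = x := fun α x => by rw [← mul_assoc, huv, one_mul]
  have hvu' : ∀ α x, V α * (U α * x) = x := fun α x => by rw [← mul_assoc, hvu, one_mul]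
  have hf1 : f 1 1 = Coalgebra.counit := Cc.functional_injective _ <| by
    rw [hf, functional_coalgebra_counit, mul_one, hU1, hV1, mul_one, mul_one]
  have hg1 : g 1 1 = Coalgebra.counit := Cc.functional_injective _ <| by
    rw [hg, functional_coalgebra_counit, mul_one, hU1, hV1, mul_one, mul_one]
  have hfl : ∀ α, f 1 α = Coalgebra.counit := fun α => Cc.functional_injective _ <| by
    rw [hf, functional_coalgebra_counit, one_mul, hU1, one_mul, huv]
  have hfr : ∀ α, f α 1 = Coalgebra.counit := fun α => Cc.functional_injective _ <| by
    rw [hf, functional_coalgebra_counit, mul_one, hU1, mul_one, huv]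
  have hfg : ∀ α β, convF k (Cc.C 1) (f α β) (g α β) = Coalgebra.counit := fun α β =>
    Cc.functional_injective _ <| by
      simp only [functional_convF, hf, hg, functional_coalgebra_counit, mul_assoc, huv, huv', hvu']
  have hgf : ∀ α β, convF k (Cc.C 1) (g α β) (f α β) = Coalgebra.counit := fun α β =>
    Cc.functional_injective _ <| by
      simp only [functional_convF, hf, hg, functional_coalgebra_counit, mul_assoc, huv, hvu']
  refine ⟨{ C := Cc.C 1, lam, f, g },
    ⟨⟨hfg 1 1, hgf 1 1, ?_⟩, fun α β => ⟨hfg α β, hgf α β⟩, fun α => ⟨?_, ?_⟩,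
      fun α β γ => ?_, fun α β => ?_⟩, fun α => ⟨hfr α, hfl α⟩, φ, ?_, ?_⟩
  · refine LinearMap.ext_of_dual fun a => Cc.functional_injective _ ?_
    refine (hlam 1 a).trans (Eq.symm ?_)
    refine (Cc.functional_comp_convMF _ _ _).trans ?_
    simp only [functional_comp_convFM, hf1, hg1, functional_coalgebra_counit, hU1, hV1, one_mul,
      mul_one, LinearMap.comp_id]
  · exact (hfl α).trans hf1.symm
  · refine (hfr α).trans (Cc.functional_injective _ ?_)
    refine Eq.symm ((hlam α (f 1 1)).trans ?_)
    rw [hf1, functional_coalgebra_counit, mul_one, huv]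
  · change convF k (Cc.C 1) (f β γ ∘ₗ (lam α).toLinearMap) (f α (β * γ)) =
      convF k (Cc.C 1) (f α β) (f (α * β) γ)
    apply Cc.functional_injective
    simp only [functional_convF, hlam, hf, mul_assoc, hvu']
  · change convMF k (Cc.C 1) ((lam β).toLinearMap ∘ₗ (lam α).toLinearMap) (f α β) =
      convFM k (Cc.C 1) (f α β) (lam (α * β)).toLinearMap
    refine LinearMap.ext_of_dual fun a => Cc.functional_injective _ ?_
    simp only [functional_comp_convMF, functional_comp_convFM, ← LinearMap.comp_assoc, hlam, hf,
      mul_assoc, hvu']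
  · change g 1 1 ∘ₗ (φ 1).toLinearMap = Cc.ε
    apply Cc.functional_injective
    rw [hφ, hg1, hU1, functional_coalgebra_counit, functional_counit, one_mul]
  · intro γ α β h
    refine LinearMap.ext_of_dual_tmul fun a b => Cc.functional_injective _ ?_
    rw [mul'_map_comp_map_comp_comul, functional_conv, hφ, hφ]
    have hδ := CrossedData.mul'_map_comp_delta { C := Cc.C 1, lam, f, g } α β a b
    rw [← LinearMap.comp_assoc, ← LinearMap.comp_assoc,
      LinearMap.comp_assoc _ (TensorProduct.map a b), hδ]
    refine Eq.symm ((hφ γ _).trans ?_)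
    subst h
    simp only [functional_convF, hlam, hf, mul_assoc, hvu, hvu', mul_one]

end GCoalgebra

/-- **Theorem 3.4.** For a `G`-coalgebra `C̲` the following are equivalent:
(1) `C̲` is cocleft; (2) `C̲` is isomorphic to a crossed coproduct `C ⋊_f k⟨G⟩`;
(3) `C̲` is isomorphic to a crossed coproduct with normalized factor set;
(4) `C̲` is strong and every `C_α` is isomorphic to `C_e` as a left `C_e`-comodule. -/
theorem cocleft_tfae {k G : Type u} [Field k] [Group G] (Cc : GCoalgebra k G) :
    List.TFAE
      [ Cc.Cocleft,
        ∃ D : CrossedData k G, D.IsFactorSet ∧ IsoToCrossed Cc D,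
        ∃ D : CrossedData k G, D.IsFactorSet ∧ D.Normalized ∧ IsoToCrossed Cc D,
        Cc.Strong ∧ ∀ α : G, LeftCeIso Cc α ] := by
  tfae_have 1 → 3 := fun hc => hc.exists_isoToCrossed
  tfae_have 3 → 2 := fun ⟨D, hD, _, hiso⟩ => ⟨D, hD, hiso⟩
  tfae_have 2 → 1 := fun ⟨_, hD, hiso⟩ => hD.cocleft hiso
  tfae_have 1 → 4 := fun hc => ⟨hc.strong, hc.leftCeIso⟩
  tfae_have 4 → 1 := fun ⟨hs, hiso⟩ => hs.cocleft hiso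
  tfae_finish
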